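/- Let M be a finite monoid and m ∈ ℕ. Then: (i) if M is J-trivial, the equation U_1 = V_1 holds in M; (ii) if M ∈ R_{m+1}, the equation (U_m x_{m+1})^π U_m = (U_m x_{m+1})^π V_m holds in M; (iii) if M ∈ L_{m+1}, the equation U_m (y_{m+1} U_m)^π = V_m (y_{m+1} U_m)^π holds in M; (iv) if M ∈ R_{m+1} ∩ L_{m+1}, the equation U_m = V_m holds in M. -/

import Mathlib

open scoped Classical

/-! ## Generalized words -/

structure GWord (A : Type) : Type 1 where
  P : Type
  ord : LinearOrder P
  w : P → A

namespace GWord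

variable {A : Type}

instance (u : GWord A) : LinearOrder u.P := u.ord

/-- The set of letters occurring in a generalized word. -/
def alph (u : GWord A) : Set A := Set.range u.w

/-- Restriction of a generalized word to a set of positions. -/
def restrict (u : GWord A) (s : Set u.P) : GWord A :=
  ⟨{ p // p ∈ s }, inferInstance, fun p => u.w p.1⟩

/-- `p` is the first `a`-labelled position of `u`. -/
def IsFirst (u : GWord A) (a : A) (p : u.P) : Prop :=
  u.w p = a ∧ ∀ q : u.P, u.w q = a → p ≤ q

/-- `p` is the last `a`-labelled position of `u`. -/
def IsLast (u : GWord A) (a : A) (p : u.P) : Prop :=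
  u.w p = a ∧ ∀ q : u.P, u.w q = a → q ≤ p

/-- The factor strictly before the first occurrence of `a`. -/
noncomputable def XL (u : GWord A) (a : A) : GWord A :=
  if h : ∃ p, u.IsFirst a p then u.restrict {q | q < h.choose} else u

/-- The factor strictly after the first occurrence of `a`. -/
noncomputable def XR (u : GWord A) (a : A) : GWord A :=
  if h : ∃ p, u.IsFirst a p then u.restrict {q | h.choose < q} else u

/-- The factor strictly before the last occurrence of `a`. -/
noncomputable def YL (u : GWord A) (a : A) : GWord A :=
  if h : ∃ p, u.IsLast a p then u.restrict {q | q < h.choose} else u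

/-- The factor strictly after the last occurrence of `a`. -/
noncomputable def YR (u : GWord A) (a : A) : GWord A :=
  if h : ∃ p, u.IsLast a p then u.restrict {q | h.choose < q} else u

/-- `C_{a,b}` is defined iff the first `a` is strictly to the right of the last `b`. -/
def CDefined (u : GWord A) (a b : A) : Prop :=
  ∃ p q, u.IsFirst a p ∧ u.IsLast b q ∧ q < p

/-- The factor strictly between the last `b` and the first `a` (junk value if undefined). -/
noncomputable def Cab (u : GWord A) (a b : A) : GWord A :=
  if h : u.CDefined a b then
    u.restrict {r | h.choose_spec.choose < r ∧ r < h.choose}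
  else u

/-- Accessibility: first/last occurrences of letters after/before every position exist. -/
def Accessible (u : GWord A) : Prop :=
  (∀ a : A, (∃ p, u.w p = a) → ∃ p, u.IsFirst a p) ∧
  (∀ a : A, (∃ p, u.w p = a) → ∃ p, u.IsLast a p) ∧
  (∀ (p : u.P) (a : A), (∃ q, p < q ∧ u.w q = a) →
    ∃ q, p < q ∧ u.w q = a ∧ ∀ r, p < r → u.w r = a → q ≤ r) ∧
  (∀ (p : u.P) (a : A), (∃ q, q < p ∧ u.w q = a) →
    ∃ q, q < p ∧ u.w q = a ∧ ∀ r, r < p → u.w r = a → r ≤ q)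

/-- Concatenation of generalized words. -/
def append (u v : GWord A) : GWord A :=
  ⟨u.P ⊕ₗ v.P, inferInstance, fun x => Sum.elim u.w v.w (ofLex x)⟩

/-- The power of a generalized word by an arbitrary linear order type `ν`
(positions ordered with the exponent component dominant). -/
def gpow (u : GWord A) (ν : Type) [LinearOrder ν] : GWord A :=
  ⟨ν ×ₗ u.P, inferInstance, fun x => u.w (ofLex x).2⟩

/-- A finite word as a generalized word. -/
def ofList (l : List A) : GWord A :=
  ⟨Fin l.length, inferInstance, fun i => l.get i⟩

end GWord

/-- The order type `ω + ω*`: a copy of `ℕ` followed by a reversed copy of `ℕ`. -/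
abbrev OO : Type := ℕ ⊕ₗ ℕᵒᵈ

/-! ## The relations `≡_{m,n}^Z` -/

inductive ZK : Type
  | X | Y | WI

inductive ZKind : Type
  | X | Y | XY | WI

/-- The relations `≡_{m,n}^X`, `≡_{m,n}^Y`, `≡_{m,n}^{WI}` (first argument is `n`). -/
def eqvAux {A : Type} : ℕ → ZK → ℕ → GWord A → GWord A → Prop
  | 0, _, _, _, _ => True
  | _ + 1, _, 0, _, _ => True
  | n + 1, ZK.X, m + 1, u, v =>
      u.alph = v.alph ∧ eqvAux n ZK.Y m u v ∧
      ∀ a ∈ u.alph, eqvAux n ZK.Y m (u.XL a) (v.XL a) ∧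
        eqvAux n ZK.X (m + 1) (u.XR a) (v.XR a)
  | n + 1, ZK.Y, m + 1, u, v =>
      u.alph = v.alph ∧ eqvAux n ZK.X m u v ∧
      ∀ a ∈ u.alph, eqvAux n ZK.Y (m + 1) (u.YL a) (v.YL a) ∧
        eqvAux n ZK.X m (u.YR a) (v.YR a)
  | n + 1, ZK.WI, m + 1, u, v =>
      u.alph = v.alph ∧
      (∀ a ∈ u.alph,
        eqvAux n ZK.WI m (u.XL a) (v.XL a) ∧ eqvAux n ZK.WI (m + 1) (u.XR a) (v.XR a) ∧
        eqvAux n ZK.WI (m + 1) (u.YL a) (v.YL a) ∧ eqvAux n ZK.WI m (u.YR a) (v.YR a)) ∧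
      ∀ a ∈ u.alph, ∀ b ∈ u.alph,
        (u.CDefined a b ↔ v.CDefined a b) ∧
        (u.CDefined a b → v.CDefined a b → eqvAux n ZK.WI m (u.Cab a b) (v.Cab a b))

/-- `wEquiv Z m n u v` is `u ≡_{m,n}^Z v`. -/
def wEquiv {A : Type} (Z : ZKind) (m n : ℕ) (u v : GWord A) : Prop :=
  match Z with
  | ZKind.X => eqvAux n ZK.X m u v
  | ZKind.Y => eqvAux n ZK.Y m u v
  | ZKind.XY => eqvAux n ZK.X m u v ∧ eqvAux n ZK.Y m u v
  | ZKind.WI => eqvAux n ZK.WI m u v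

/-! ## π-terms -/

inductive PiTerm (A : Type) : Type
  | eps : PiTerm A
  | letter : A → PiTerm A
  | mul : PiTerm A → PiTerm A → PiTerm A
  | pi : PiTerm A → PiTerm A

def listNPow {A : Type} (l : List A) : ℕ → List A
  | 0 => []
  | k + 1 => l ++ listNPow l k

/-- `[γ]_k`: substitute the natural number `k` for the formal power `π`. -/
def PiTerm.substNat {A : Type} : PiTerm A → ℕ → List A
  | .eps, _ => []
  | .letter a, _ => [a]
  | .mul α β, k => α.substNat k ++ β.substNat k
  | .pi γ, k => listNPow (γ.substNat k) k

/-- `[γ]_{ω+ω*}`: substitute the order type `ω + ω*` for the formal power `π`. -/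
def PiTerm.substOO {A : Type} : PiTerm A → GWord A
  | .eps => GWord.ofList []
  | .letter a => GWord.ofList [a]
  | .mul α β => α.substOO.append β.substOO
  | .pi γ => γ.substOO.gpow OO

/-! ## Finite monoids, equations, the Trotter–Weil hierarchy -/

/-- `M!`: the exponent of a finite monoid, the least `n ≥ 1` such that all `x^n` are
idempotent. -/
noncomputable def monoidExp (M : Type) [Monoid M] : ℕ :=
  sInf {n : ℕ | 1 ≤ n ∧ ∀ x : M, IsIdempotentElem (x ^ n)}

/-- The equation `α = β` of π-terms holds in the finite monoid `M`. -/
def EqHoldsIn {A : Type} (α β : PiTerm A) (M : Type) [Monoid M] : Prop :=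
  ∀ σ : FreeMonoid A →* M,
    σ (FreeMonoid.ofList (α.substNat (monoidExp M))) =
      σ (FreeMonoid.ofList (β.substNat (monoidExp M)))

/-- Green's relation `R`: `x R y` iff `xM = yM`. -/
def rGreen {M : Type} [Monoid M] (x y : M) : Prop :=
  Set.range (fun z => x * z) = Set.range (fun z => y * z)

/-- Green's relation `L`: `x L y` iff `Mx = My`. -/
def lGreen {M : Type} [Monoid M] (x y : M) : Prop :=
  Set.range (fun z => z * x) = Set.range (fun z => z * y)

/-- `J`-triviality: `MxM = MyM` implies `x = y`. -/
def IsJTrivial (M : Type) [Monoid M] : Prop :=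
  ∀ x y : M, {z | ∃ a b, z = a * x * b} = {z | ∃ a b, z = a * y * b} → x = y

/-- The relation `∼_K`. -/
def simK {M : Type} [Monoid M] (x y : M) : Prop :=
  ∀ e : M, IsIdempotentElem e → (rGreen (e * x) e ∨ rGreen (e * y) e) → e * x = e * y

/-- The relation `∼_D`. -/
def simD {M : Type} [Monoid M] (x y : M) : Prop :=
  ∀ e : M, IsIdempotentElem e → (lGreen (x * e) e ∨ lGreen (y * e) e) → x * e = y * e

/-- `∼_K` as a congruence (it is a congruence, so `conGen` does not change it). -/
def KCon (M : Type) [Monoid M] : Con M := conGen simK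

/-- `∼_D` as a congruence. -/
def DCon (M : Type) [Monoid M] : Con M := conGen simD

/-- `InRLAux k true M _ = (M ∈ R_{k+1})` and `InRLAux k false M _ = (M ∈ L_{k+1})`. -/
def InRLAux : ℕ → Bool → (M : Type) → Monoid M → Prop
  | 0, _, M, i => letI := i; IsJTrivial M
  | k + 1, true, M, i => letI := i; InRLAux k false (KCon M).Quotient inferInstance
  | k + 1, false, M, i => letI := i; InRLAux k true (DCon M).Quotient inferInstance

/-- `M ∈ R_m` (for `m ≥ 1`). -/
def InRm (m : ℕ) (M : Type) [i : Monoid M] : Prop := InRLAux (m - 1) true M i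

/-- `M ∈ L_m` (for `m ≥ 1`). -/
def InLm (m : ℕ) (M : Type) [i : Monoid M] : Prop := InRLAux (m - 1) false M i

/-- `N` divides `M`: `N` is a homomorphic image of a submonoid of `M`. -/
def MDivides (N M : Type) [Monoid N] [Monoid M] : Prop :=
  ∃ (S : Submonoid M) (f : S →* N), Function.Surjective f

/-- `N ∈ R_m ∨ L_m`: `N` divides a direct product `M₁ × M₂` with `M₁ ∈ R_m`, `M₂ ∈ L_m`. -/
def InJoin (m : ℕ) (N : Type) [Monoid N] : Prop :=
  ∃ (M₁ M₂ : Type) (i₁ : Monoid M₁) (i₂ : Monoid M₂),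
    letI := i₁; letI := i₂;
    Finite M₁ ∧ Finite M₂ ∧ InRm m M₁ ∧ InLm m M₂ ∧ MDivides N (M₁ × M₂)

/-- `M ∈ DA`, via the equation `(xyz)^{M!} y (xyz)^{M!} = (xyz)^{M!}`. -/
def InDA (M : Type) [Monoid M] : Prop :=
  ∀ x y z : M,
    (x * y * z) ^ monoidExp M * y * (x * y * z) ^ monoidExp M = (x * y * z) ^ monoidExp M

/-! ## The π-terms `U_m`, `V_m` -/

inductive UVLetter : Type
  | s | t | x (i : ℕ) | y (i : ℕ)

/-- `U_m` (indexed from 1; `Uterm 0` is a junk value). -/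
def Uterm : ℕ → PiTerm UVLetter
  | 0 => PiTerm.eps
  | 1 =>
      PiTerm.mul
        (PiTerm.pi (PiTerm.mul (PiTerm.letter UVLetter.s) (PiTerm.letter (UVLetter.x 1))))
        (PiTerm.mul (PiTerm.letter UVLetter.s)
          (PiTerm.pi (PiTerm.mul (PiTerm.letter (UVLetter.y 1)) (PiTerm.letter UVLetter.t))))
  | m + 2 =>
      PiTerm.mul
        (PiTerm.pi (PiTerm.mul (Uterm (m + 1)) (PiTerm.letter (UVLetter.x (m + 2)))))
        (PiTerm.mul (Uterm (m + 1))
          (PiTerm.pi (PiTerm.mul (PiTerm.letter (UVLetter.y (m + 2))) (Uterm (m + 1)))))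

/-- `V_m` (indexed from 1; `Vterm 0` is a junk value). -/
def Vterm : ℕ → PiTerm UVLetter
  | 0 => PiTerm.eps
  | 1 =>
      PiTerm.mul
        (PiTerm.pi (PiTerm.mul (PiTerm.letter UVLetter.s) (PiTerm.letter (UVLetter.x 1))))
        (PiTerm.mul (PiTerm.letter UVLetter.t)
          (PiTerm.pi (PiTerm.mul (PiTerm.letter (UVLetter.y 1)) (PiTerm.letter UVLetter.t))))
  | m + 2 =>
      PiTerm.mul
        (PiTerm.pi (PiTerm.mul (Uterm (m + 1)) (PiTerm.letter (UVLetter.x (m + 2)))))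
        (PiTerm.mul (Vterm (m + 1))
          (PiTerm.pi (PiTerm.mul (PiTerm.letter (UVLetter.y (m + 2))) (Uterm (m + 1)))))

/-- The relation `≡_{m,n}^Z` on the free monoid `Σ*`, as a congruence
(it is a congruence, so `conGen` does not change it). -/
def eqvCon (A : Type) (Z : ZKind) (m n : ℕ) : Con (FreeMonoid A) :=
  conGen (fun u v => wEquiv Z m n (GWord.ofList u.toList) (GWord.ofList v.toList))

/-! ## Idempotent powers and Green's relations -/

section Green

variable {M : Type} [Monoid M]

instance finite_mulOpposite [Finite M] : Finite Mᵐᵒᵖ :=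
  Finite.of_equiv M MulOpposite.opEquiv

instance finite_con_quotient [Finite M] (c : Con M) : Finite c.Quotient :=
  Finite.of_surjective _ c.mk'_surjective

theorem exists_pos_isIdempotentElem_pow (x : M) [Finite M] :
    ∃ n : ℕ, 1 ≤ n ∧ IsIdempotentElem (x ^ n) := by
  obtain ⟨i, j, hij, h⟩ := Set.finite_univ.exists_lt_map_eq_of_forall_mem
    (f := fun n : ℕ => x ^ n) (fun _ => Set.mem_univ _)
  obtain ⟨d, rfl⟩ := Nat.exists_eq_add_of_lt hij
  have hstep : ∀ t k : ℕ, x ^ (i + k + t * (d + 1)) = x ^ (i + k) := by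
    intro t k
    induction t with
    | zero => simp
    | succ t ih =>
      calc x ^ (i + k + (t + 1) * (d + 1))
          = x ^ (i + d + 1) * x ^ (k + t * (d + 1)) := by rw [← pow_add]; congr 1; ring
        _ = x ^ i * x ^ (k + t * (d + 1)) := by rw [← h]
        _ = x ^ (i + k) := by rw [← pow_add, ← add_assoc, ih]
  refine ⟨i + (i * d + d + 1), by omega, ?_⟩
  have := hstep (i + 1) (i * d + d + 1)
  rw [IsIdempotentElem, ← pow_add, ← this]
  congr 1
  ring

theorem exists_forall_isIdempotentElem_pow (M : Type) [Monoid M] [Finite M] :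
    ∃ n : ℕ, 1 ≤ n ∧ ∀ x : M, IsIdempotentElem (x ^ n) := by
  have := Fintype.ofFinite M
  choose n hn hid using fun x : M => exists_pos_isIdempotentElem_pow x
  refine ⟨∏ x, n x, Finset.one_le_prod' fun x _ => hn x, fun x => ?_⟩
  obtain ⟨c, hc⟩ := Finset.dvd_prod_of_mem n (Finset.mem_univ x)
  rw [hc, pow_mul]
  exact (hid x).pow c

theorem monoidExp_spec (M : Type) [Monoid M] [Finite M] :
    1 ≤ monoidExp M ∧ ∀ x : M, IsIdempotentElem (x ^ monoidExp M) :=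
  Nat.sInf_mem (s := {n : ℕ | 1 ≤ n ∧ ∀ x : M, IsIdempotentElem (x ^ n)})
    (exists_forall_isIdempotentElem_pow M)

theorem rGreen_mul_self_iff {s x : M} : rGreen (s * x) s ↔ ∃ z, s * x * z = s := by
  constructor
  · intro h
    have : s ∈ Set.range fun z => s * z := ⟨1, mul_one s⟩
    rwa [← h] at this
  · rintro ⟨z, hz⟩
    ext w
    constructor
    · rintro ⟨v, rfl⟩
      exact ⟨x * v, (mul_assoc _ _ _).symm⟩
    · rintro ⟨v, rfl⟩
      exact ⟨z * v, by simp only [← mul_assoc, hz]⟩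

theorem lGreen_mul_self_iff {s x : M} : lGreen (x * s) s ↔ ∃ z, z * (x * s) = s := by
  constructor
  · intro h
    have : s ∈ Set.range fun z => z * s := ⟨1, one_mul s⟩
    rwa [← h] at this
  · rintro ⟨z, hz⟩
    ext w
    constructor
    · rintro ⟨v, rfl⟩
      exact ⟨v * x, mul_assoc _ _ _⟩
    · rintro ⟨v, rfl⟩
      exact ⟨v * z, by simp only [mul_assoc, hz]⟩

theorem mul_pow_eq_self {s w : M} (h : s * w = s) (n : ℕ) : s * w ^ n = s := by
  induction n with
  | zero => simp
  | succ n ih => rw [pow_succ', ← mul_assoc, h, ih]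

theorem pow_mul_eq_self {s w : M} (h : w * s = s) (n : ℕ) : w ^ n * s = s := by
  induction n with
  | zero => simp
  | succ n ih => rw [pow_succ, mul_assoc, h, ih]

end Green

/-! ## The relations `∼_K` and `∼_D` -/

section Congruences

variable {M : Type} [Monoid M]

theorem simK.symm {x y : M} (h : simK x y) : simK y x :=
  fun e he h' => (h e he h'.symm).symm

theorem simK.mul_eq_mul [Finite M] {x y s z : M} (h : simK x y) (hz : s * x * z = s) :
    s * x = s * y := by
  obtain ⟨n, hn, hid⟩ := exists_forall_isIdempotentElem_pow M
  obtain ⟨k, rfl⟩ := Nat.exists_eq_add_of_le' hn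
  have hg : (x * z) ^ (k + 1) * x = (x * z) ^ (k + 1) * y :=
    h _ (hid _) <| .inl <| rGreen_mul_self_iff.2 ⟨z * (x * z) ^ k, by
      simpa only [pow_succ', mul_assoc] using (hid (x * z)).eq⟩
  have hs : s * (x * z) ^ (k + 1) = s := mul_pow_eq_self (by rw [← mul_assoc, hz]) _
  rw [← hs, mul_assoc, hg, ← mul_assoc, hs]

theorem simK.of_forall {x y : M}
    (h : ∀ s z : M, s * x * z = s ∨ s * y * z = s → s * x = s * y) : simK x y := by
  rintro e - (he | he) <;> obtain ⟨z, hz⟩ := rGreen_mul_self_iff.1 he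
  exacts [h e z (.inl hz), h e z (.inr hz)]

theorem simK.trans {x y w : M} (h : simK x y) (h' : simK y w) : simK x w := by
  rintro e he (hx | hw)
  · have hxy := h e he (.inl hx)
    exact hxy.trans (h' e he (.inl (hxy ▸ hx)))
  · have hyw := h' e he (.inr hw)
    exact (h e he (.inr (hyw.symm ▸ hw))).trans hyw

theorem simK.mul [Finite M] {x x' y y' : M} (hx : simK x x') (hy : simK y y') :
    simK (x * y) (x' * y') := by
  have key : ∀ {x x' y y' s z : M}, simK x x' → simK y y' → s * (x * y) * z = s →
      s * (x * y) = s * (x' * y') := by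
    intro x x' y y' s z hx hy hz
    have h₁ : s * x = s * x' := hx.mul_eq_mul (z := y * z) (by simpa only [mul_assoc] using hz)
    have h₂ : s * x * y = s * x * y' := hy.mul_eq_mul (z := z * x) (by
      rw [← mul_assoc, mul_assoc s x y, hz])
    rw [← mul_assoc, h₂, h₁, mul_assoc]
  refine .of_forall fun s z h => h.elim (key hx hy) fun h => (key hx.symm hy.symm h).symm

theorem KCon_iff [Finite M] {x y : M} : KCon M x y ↔ simK x y := by
  let c : Con M :=
    { r := simK
      iseqv := ⟨fun _ _ _ _ => rfl, simK.symm, simK.trans⟩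
      mul' := simK.mul }
  exact ⟨fun h => (Con.conGen_le (c := c)).2 (fun _ _ h => h) h, fun h => Con.le_conGen _ _ h⟩

open MulOpposite in
theorem simD_iff_op {x y : M} : simD x y ↔ simK (op x) (op y) := by
  have green : ∀ x e : M, lGreen (x * e) e ↔ rGreen (op e * op x) (op e) := fun x e => by
    rw [rGreen_mul_self_iff, lGreen_mul_self_iff]
    exact ⟨fun ⟨z, hz⟩ => ⟨op z, congrArg op hz⟩, fun ⟨z, hz⟩ => ⟨z.unop, congrArg unop hz⟩⟩
  constructor
  · intro h e he h'
    exact congrArg op (h e.unop (congrArg unop he)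
      (h'.imp (green x e.unop).2 (green y e.unop).2))
  · intro h e he h'
    exact congrArg unop (h (op e) (congrArg op he) (h'.imp (green x e).1 (green y e).1))

theorem simD.symm {x y : M} (h : simD x y) : simD y x :=
  fun e he h' => (h e he h'.symm).symm

theorem simD.mul_eq_mul [Finite M] {x y s z : M} (h : simD x y) (hz : z * (x * s) = s) :
    x * s = y * s :=
  congrArg MulOpposite.unop <| (simD_iff_op.1 h).mul_eq_mul (s := .op s) (z := .op z)
    (congrArg MulOpposite.op hz)

theorem simD.of_forall {x y : M}
    (h : ∀ s z : M, z * (x * s) = s ∨ z * (y * s) = s → x * s = y * s) : simD x y := by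
  rintro e - (he | he) <;> obtain ⟨z, hz⟩ := lGreen_mul_self_iff.1 he
  exacts [h e z (.inl hz), h e z (.inr hz)]

theorem DCon_iff [Finite M] {x y : M} : DCon M x y ↔ simD x y := by
  let c : Con M :=
    { r := simD
      iseqv := ⟨fun _ _ _ _ => rfl, simD.symm, fun h h' =>
        simD_iff_op.2 ((simD_iff_op.1 h).trans (simD_iff_op.1 h'))⟩
      mul' := fun h h' => simD_iff_op.2 ((simD_iff_op.1 h').mul (simD_iff_op.1 h)) }
  exact ⟨fun h => (Con.conGen_le (c := c)).2 (fun _ _ h => h) h, fun h => Con.le_conGen _ _ h⟩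

/-- The join of the congruences `∼_K` and `∼_D`. -/
def KDCon (M : Type) [Monoid M] : Con M where
  r := Relation.EqvGen fun x y => KCon M x y ∨ DCon M x y
  iseqv := Relation.EqvGen.is_equivalence _
  mul' := by
    intro w x y z hwx hyz
    refine Relation.EqvGen.trans _ (x * y) _ ?_ ?_
    · induction hwx with
      | rel a b h =>
        exact .rel _ _ (h.imp (fun h => h.mul ((KCon M).refl y)) fun h => h.mul ((DCon M).refl y))
      | refl => exact .refl _
      | symm _ _ _ ih => exact ih.symm
      | trans _ _ _ _ _ ih ih' => exact ih.trans _ _ _ ih'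
    · induction hyz with
      | rel a b h =>
        exact .rel _ _ (h.imp (fun h => ((KCon M).refl x).mul h) fun h => ((DCon M).refl x).mul h)
      | refl => exact .refl _
      | symm _ _ _ ih => exact ih.symm
      | trans _ _ _ _ _ ih ih' => exact ih.trans _ _ _ ih'

theorem KCon_le_KDCon : KCon M ≤ KDCon M := fun {_ _} h => .rel _ _ (.inl h)

theorem DCon_le_KDCon : DCon M ≤ KDCon M := fun {_ _} h => .rel _ _ (.inr h)

/-- If `p` is `R`-equivalent to `p * u`, `q` is `L`-equivalent to `u * q` and `u ∼_K v`, then the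
same holds for `v`, and `u` and `v` may be exchanged between `p` and `q`. -/
theorem simK.sandwich [Finite M] {u v p q : M} (h : simK u v)
    (hp : ∃ z, p * u * z = p) (hq : ∃ z, z * (u * q) = q) :
    (∃ z, p * v * z = p) ∧ (∃ z, z * (v * q) = q) ∧ p * u * q = p * v * q := by
  obtain ⟨z, hz⟩ := hp
  obtain ⟨w, hw⟩ := hq
  have hpu : p * u = p * v := h.mul_eq_mul hz
  refine ⟨⟨z, hpu ▸ hz⟩, ?_, by rw [hpu]⟩
  obtain ⟨n, hn, hid⟩ := exists_forall_isIdempotentElem_pow M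
  obtain ⟨k, rfl⟩ := Nat.exists_eq_add_of_le' hn
  have hg : (w * u) ^ (k + 1) * w * u = (w * u) ^ (k + 1) * w * v :=
    h.mul_eq_mul (z := (w * u) ^ k * w) (by
      calc (w * u) ^ (k + 1) * w * u * ((w * u) ^ k * w)
          = (w * u) ^ (k + 1) * (w * u) ^ (k + 1) * w := by
            simp only [pow_succ', mul_assoc]
        _ = _ := by rw [(hid _).eq])
  refine ⟨(w * u) ^ (k + 1) * w, ?_⟩
  have hwq : w * u * q = q := by rw [mul_assoc, hw]
  rw [← mul_assoc, ← hg, mul_assoc _ w u, mul_assoc, hwq, pow_mul_eq_self hwq]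

theorem simD.sandwich [Finite M] {u v p q : M} (h : simD u v)
    (hp : ∃ z, p * u * z = p) (hq : ∃ z, z * (u * q) = q) :
    (∃ z, p * v * z = p) ∧ (∃ z, z * (v * q) = q) ∧ p * u * q = p * v * q := by
  open MulOpposite in
  obtain ⟨z, hz⟩ := hp
  obtain ⟨w, hw⟩ := hq
  obtain ⟨⟨w', hw'⟩, ⟨z', hz'⟩, heq⟩ := (simD_iff_op.1 h).sandwich (p := op q) (q := op p)
    ⟨op w, congrArg op hw⟩ ⟨op z, congrArg op hz⟩
  refine ⟨⟨z'.unop, congrArg unop hz'⟩, ⟨w'.unop, congrArg unop hw'⟩, ?_⟩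
  simpa only [← op_mul, op_inj, ← mul_assoc] using heq

theorem KDCon.mul_mul_eq [Finite M] {u v p q : M} (h : KDCon M u v)
    (hp : ∃ z, p * u * z = p) (hq : ∃ z, z * (u * q) = q) : p * u * q = p * v * q := by
  let good (u : M) : Prop := (∃ z, p * u * z = p) ∧ ∃ z, z * (u * q) = q
  have key : (good u ↔ good v) ∧ (good u → p * u * q = p * v * q) := by
    have hgen : Relation.EqvGen (fun x y => KCon M x y ∨ DCon M x y) u v := h
    clear h hp hq
    induction hgen with
    | rel a b h =>
      have sandwich : ∀ {a b : M}, KCon M a b ∨ DCon M a b → good a →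
          good b ∧ p * a * q = p * b * q := by
        rintro a b h ⟨ha, ha'⟩
        obtain ⟨h₁, h₂, h₃⟩ := h.elim (fun h => (KCon_iff.1 h).sandwich ha ha')
          fun h => (DCon_iff.1 h).sandwich ha ha'
        exact ⟨⟨h₁, h₂⟩, h₃⟩
      exact ⟨⟨fun ha => (sandwich h ha).1, fun hb => (sandwich (h.imp (·.symm) (·.symm)) hb).1⟩,
        fun ha => (sandwich h ha).2⟩
    | refl => exact ⟨Iff.rfl, fun _ => rfl⟩
    | symm _ _ _ ih => exact ⟨ih.1.symm, fun h => (ih.2 (ih.1.2 h)).symm⟩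
    | trans _ _ _ _ _ ih ih' =>
      exact ⟨ih.1.trans ih'.1, fun h => (ih.2 h).trans (ih'.2 (ih.1.1 h))⟩
  exact key.2 ⟨hp, hq⟩

end Congruences

/-! ## Closure of the Trotter–Weil hierarchy under quotients -/

section Quotients

variable {M N : Type} [Monoid M] [Monoid N]

theorem IsJTrivial.mul_right_eq (h : IsJTrivial M) {a b : M} (c d : M) (hb : b = a * c)
    (ha : a = b * d) : b = a := by
  refine h _ _ (Set.Subset.antisymm ?_ ?_)
  · rintro _ ⟨p, q, rfl⟩
    exact ⟨p, c * q, by rw [hb]; simp only [mul_assoc]⟩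
  · rintro _ ⟨p, q, rfl⟩
    exact ⟨p, d * q, by rw [← mul_assoc, mul_assoc p b d, ← ha]⟩

theorem IsJTrivial.mul_left_eq (h : IsJTrivial M) {a b : M} (c d : M) (hb : b = c * a)
    (ha : a = d * b) : b = a := by
  refine h _ _ (Set.Subset.antisymm ?_ ?_)
  · rintro _ ⟨p, q, rfl⟩
    exact ⟨p * c, q, by rw [hb]; simp only [mul_assoc]⟩
  · rintro _ ⟨p, q, rfl⟩
    exact ⟨p * d, q, by rw [mul_assoc p d b, ← ha]⟩

theorem IsJTrivial.pow_mul_eq (h : IsJTrivial M) {n : ℕ} (hn : 1 ≤ n)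
    (hid : ∀ x : M, IsIdempotentElem (x ^ n)) (x y : M) : (x * y) ^ n * x = (x * y) ^ n := by
  obtain ⟨k, rfl⟩ := Nat.exists_eq_add_of_le' hn
  refine h.mul_right_eq x (y * (x * y) ^ k) rfl ?_
  calc (x * y) ^ (k + 1) = (x * y) ^ (k + 1) * (x * y) ^ (k + 1) := (hid _).eq.symm
    _ = _ := by simp only [pow_succ', mul_assoc]

theorem IsJTrivial.mul_pow_eq (h : IsJTrivial M) {n : ℕ} (hn : 1 ≤ n)
    (hid : ∀ x : M, IsIdempotentElem (x ^ n)) (x y : M) : y * (x * y) ^ n = (x * y) ^ n := by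
  obtain ⟨k, rfl⟩ := Nat.exists_eq_add_of_le' hn
  refine h.mul_left_eq y ((x * y) ^ k * x) rfl ?_
  calc (x * y) ^ (k + 1) = (x * y) ^ (k + 1) * (x * y) ^ (k + 1) := (hid _).eq.symm
    _ = (x * y) ^ k * (x * y) * (x * y) ^ (k + 1) := by rw [pow_succ]
    _ = _ := by simp only [mul_assoc]

theorem isJTrivial_of_pow_mul_eq {n : ℕ} (hr : ∀ x y : M, (x * y) ^ n * x = (x * y) ^ n)
    (hl : ∀ x y : M, y * (x * y) ^ n = (x * y) ^ n) : IsJTrivial M := by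
  intro x y h
  obtain ⟨a, b, hy⟩ : ∃ a b, y = a * x * b :=
    (Set.ext_iff.1 h y).2 ⟨1, 1, by simp⟩
  obtain ⟨c, d, hx⟩ : ∃ c d, x = c * y * d :=
    (Set.ext_iff.1 h x).1 ⟨1, 1, by simp⟩
  have hxx : ∀ k : ℕ, x = (c * a) ^ k * x * (b * d) ^ k := by
    intro k
    induction k with
    | zero => simp
    | succ k ih =>
      calc x = (c * a) ^ k * (c * (a * x * b) * d) * (b * d) ^ k := by rw [← hy, ← hx, ← ih]
        _ = _ := by rw [pow_succ, pow_succ']; simp only [mul_assoc]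
  calc x = (c * a) ^ n * x * (b * d) ^ n := hxx n
    _ = a * (c * a) ^ n * x * ((b * d) ^ n * b) := by rw [hr, hl]
    _ = a * ((c * a) ^ n * x * (b * d) ^ n) * b := by simp only [mul_assoc]
    _ = y := by rw [← hxx, ← hy]

theorem IsJTrivial.of_surjective [Finite M] (f : M →* N) (hf : Function.Surjective f)
    (h : IsJTrivial M) : IsJTrivial N := by
  obtain ⟨n, hn, hid⟩ := exists_forall_isIdempotentElem_pow M
  refine isJTrivial_of_pow_mul_eq (n := n) (hf.forall₂.2 fun x y => ?_) (hf.forall₂.2 fun x y => ?_)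
  · simp only [← map_mul, ← map_pow, h.pow_mul_eq hn hid]
  · simp only [← map_mul, ← map_pow, h.mul_pow_eq hn hid]

theorem simK.map_of_surjective [Finite M] (f : M →* N) (hf : Function.Surjective f) {x y : M}
    (h : simK x y) : simK (f x) (f y) := by
  obtain ⟨n, hn, hid⟩ := exists_forall_isIdempotentElem_pow M
  obtain ⟨k, rfl⟩ := Nat.exists_eq_add_of_le' hn
  have key : ∀ {x y : M} (s z : N), simK x y → s * f x * z = s → s * f x = s * f y := by
    intro x y s z h hz
    obtain ⟨s, rfl⟩ := hf s
    obtain ⟨z, rfl⟩ := hf z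
    have hs : f (s * (x * z) ^ (k + 1)) = f s := by
      rw [map_mul, map_pow]
      exact mul_pow_eq_self (by rw [map_mul, ← mul_assoc, hz]) _
    have hxy : s * (x * z) ^ (k + 1) * x = s * (x * z) ^ (k + 1) * y :=
      h.mul_eq_mul (z := z * (x * z) ^ k) (by
        calc s * (x * z) ^ (k + 1) * x * (z * (x * z) ^ k)
            = s * ((x * z) ^ (k + 1) * (x * z) ^ (k + 1)) := by
              simp only [pow_succ', mul_assoc]
          _ = _ := by rw [(hid _).eq])
    rw [← hs, ← map_mul, hxy, map_mul]
  exact .of_forall fun s z h' => h'.elim (key s z h) fun h' => (key s z h.symm h').symm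

theorem simD.map_of_surjective [Finite M] (f : M →* N) (hf : Function.Surjective f) {x y : M}
    (h : simD x y) : simD (f x) (f y) :=
  simD_iff_op.2 <| (simD_iff_op.1 h).map_of_surjective (MonoidHom.op f)
    (MulOpposite.op_surjective.comp (hf.comp MulOpposite.unop_surjective))

theorem InRLAux.of_surjective (k : ℕ) (b : Bool) {M N : Type} [iM : Monoid M] [iN : Monoid N]
    [Finite M] (f : M →* N) (hf : Function.Surjective f) (h : InRLAux k b M iM) :
    InRLAux k b N iN := by
  induction k generalizing b M N with
  | zero => exact IsJTrivial.of_surjective f hf (by simpa only [InRLAux] using h)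
  | succ k ih =>
    have := Finite.of_surjective f hf
    cases b with
    | true =>
      rw [InRLAux] at h ⊢
      refine ih false ((KCon M).lift ((KCon N).mk'.comp f) fun {x y} hxy => ?_)
        (Con.lift_surjective_of_surjective _ (Con.mk'_surjective.comp hf)) h
      exact (Con.eq _).2 (KCon_iff.2 ((KCon_iff.1 hxy).map_of_surjective f hf))
    | false =>
      rw [InRLAux] at h ⊢
      refine ih true ((DCon M).lift ((DCon N).mk'.comp f) fun {x y} hxy => ?_)
        (Con.lift_surjective_of_surjective _ (Con.mk'_surjective.comp hf)) h
      exact (Con.eq _).2 (DCon_iff.2 ((DCon_iff.1 hxy).map_of_surjective f hf))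

theorem InRLAux.quotient_KDCon {k : ℕ} {M : Type} [i : Monoid M] [Finite M]
    (hR : InRLAux (k + 1) true M i) (hL : InRLAux (k + 1) false M i) (b : Bool) :
    InRLAux k b (KDCon M).Quotient inferInstance := by
  cases b with
  | true =>
    exact InRLAux.of_surjective k true (Con.map _ _ DCon_le_KDCon)
      (Con.lift_surjective_of_surjective _ Con.mk'_surjective) (by simpa only [InRLAux] using hL)
  | false =>
    exact InRLAux.of_surjective k false (Con.map _ _ KCon_le_KDCon)
      (Con.lift_surjective_of_surjective _ Con.mk'_surjective) (by simpa only [InRLAux] using hR)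

end Quotients

/-! ## Evaluation of π-terms -/

namespace PiTerm

variable {A M N : Type} [Monoid M] [Monoid N]

/-- The value of a π-term under `g`, with `n` substituted for the formal power `π`. -/
def eval (g : A → M) (n : ℕ) : PiTerm A → M
  | .eps => 1
  | .letter a => g a
  | .mul α β => α.eval g n * β.eval g n
  | .pi γ => γ.eval g n ^ n

theorem map_ofList_listNPow (σ : FreeMonoid A →* M) (l : List A) (k : ℕ) :
    σ (FreeMonoid.ofList (listNPow l k)) = σ (FreeMonoid.ofList l) ^ k := by
  induction k with
  | zero => simp [listNPow]
  | succ k ih => rw [listNPow, FreeMonoid.ofList_append, map_mul, ih, pow_succ']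

theorem map_ofList_substNat (σ : FreeMonoid A →* M) (n : ℕ) (α : PiTerm A) :
    σ (FreeMonoid.ofList (α.substNat n)) = α.eval (fun a => σ (FreeMonoid.of a)) n := by
  induction α with
  | eps => simp [substNat, eval]
  | letter a => simp [substNat, eval]
  | mul α β ihα ihβ => rw [substNat, FreeMonoid.ofList_append, map_mul, ihα, ihβ, eval]
  | pi γ ih => rw [substNat, map_ofList_listNPow, ih, eval]

theorem map_eval (f : M →* N) (g : A → M) (n : ℕ) (α : PiTerm A) :
    f (α.eval g n) = α.eval (f ∘ g) n := by
  induction α with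
  | eps => simp [eval]
  | letter a => rfl
  | mul α β ihα ihβ => simp [eval, ihα, ihβ]
  | pi γ ih => simp [eval, ih]

end PiTerm

theorem eqHoldsIn_of_eval {A M : Type} [Monoid M] {α β : PiTerm A}
    (h : ∀ g : A → M, α.eval g (monoidExp M) = β.eval g (monoidExp M)) : EqHoldsIn α β M :=
  fun σ => by simpa only [PiTerm.map_ofList_substNat] using h _

/-! ## The equations `U_m = V_m` -/

section Equations

open PiTerm

variable {M : Type} [Monoid M] {n : ℕ}

theorem eval_Uterm_one_eq (hr : ∀ x y : M, (x * y) ^ n * x = (x * y) ^ n)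
    (hl : ∀ x y : M, y * (x * y) ^ n = (x * y) ^ n) (g : UVLetter → M) :
    (Uterm 1).eval g n = (Vterm 1).eval g n := by
  simp only [Uterm, Vterm, eval, hl]
  rw [← mul_assoc, hr]

theorem isIdempotentElem_pow_quotient (hid : ∀ x : M, IsIdempotentElem (x ^ n)) (c : Con M)
    (x : c.Quotient) : IsIdempotentElem (x ^ n) := by
  obtain ⟨x, rfl⟩ := Con.mk'_surjective x
  rw [← map_pow]
  exact (hid x).map _

theorem pow_mul_mul_pow_pred (hn : 1 ≤ n) (hid : ∀ x : M, IsIdempotentElem (x ^ n)) (x y : M) :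
    ∃ z, (x * y) ^ n * x * z = (x * y) ^ n := by
  obtain ⟨k, rfl⟩ := Nat.exists_eq_add_of_le' hn
  exact ⟨y * (x * y) ^ k, by simpa only [pow_succ', mul_assoc] using (hid (x * y)).eq⟩

theorem pow_pred_mul_mul_pow (hn : 1 ≤ n) (hid : ∀ x : M, IsIdempotentElem (x ^ n)) (x y : M) :
    ∃ z, z * (x * (y * x) ^ n) = (y * x) ^ n := by
  obtain ⟨k, rfl⟩ := Nat.exists_eq_add_of_le' hn
  refine ⟨(y * x) ^ k * y, ?_⟩
  calc (y * x) ^ k * y * (x * (y * x) ^ (k + 1))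
      = (y * x) ^ k * (y * x) * (y * x) ^ (k + 1) := by simp only [mul_assoc]
    _ = _ := by rw [← pow_succ, (hid _).eq]

/-- If an equation holds in `M/∼_K`, it holds in `M` after an idempotent absorbing it. -/
theorem pow_mul_eval_eq [Finite M] (hn : 1 ≤ n) (hid : ∀ x : M, IsIdempotentElem (x ^ n))
    {A : Type} {α β : PiTerm A} {g : A → M}
    (h : α.eval ((KCon M).mk' ∘ g) n = β.eval ((KCon M).mk' ∘ g) n) (x : M) :
    (α.eval g n * x) ^ n * α.eval g n = (α.eval g n * x) ^ n * β.eval g n := by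
  rw [← map_eval, ← map_eval] at h
  obtain ⟨z, hz⟩ := pow_mul_mul_pow_pred hn hid (α.eval g n) x
  exact (KCon_iff.1 ((Con.eq _).1 h)).mul_eq_mul hz

theorem eval_mul_pow_eq [Finite M] (hn : 1 ≤ n) (hid : ∀ x : M, IsIdempotentElem (x ^ n))
    {A : Type} {α β : PiTerm A} {g : A → M}
    (h : α.eval ((DCon M).mk' ∘ g) n = β.eval ((DCon M).mk' ∘ g) n) (y : M) :
    α.eval g n * (y * α.eval g n) ^ n = β.eval g n * (y * α.eval g n) ^ n := by
  rw [← map_eval, ← map_eval] at h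
  obtain ⟨z, hz⟩ := pow_pred_mul_mul_pow hn hid (α.eval g n) y
  exact (DCon_iff.1 ((Con.eq _).1 h)).mul_eq_mul hz

theorem eval_Uterm_eq_of_inRLAux (k : ℕ) (b : Bool) {M : Type} [i : Monoid M] [Finite M]
    (hn : 1 ≤ n) (hid : ∀ x : M, IsIdempotentElem (x ^ n)) (h : InRLAux k b M i)
    (g : UVLetter → M) : (Uterm (k + 1)).eval g n = (Vterm (k + 1)).eval g n := by
  induction k generalizing b M with
  | zero =>
    have hJ : IsJTrivial M := by simpa only [InRLAux] using h
    exact eval_Uterm_one_eq (hJ.pow_mul_eq hn hid) (hJ.mul_pow_eq hn hid) g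
  | succ k ih =>
    cases b with
    | true =>
      have := pow_mul_eval_eq hn hid (ih false (isIdempotentElem_pow_quotient hid _)
        (by simpa only [InRLAux] using h) ((KCon M).mk' ∘ g)) (g (.x (k + 2)))
      simp only [Uterm, Vterm, eval, ← mul_assoc, this]
    | false =>
      have := eval_mul_pow_eq hn hid (ih true (isIdempotentElem_pow_quotient hid _)
        (by simpa only [InRLAux] using h) ((DCon M).mk' ∘ g)) (g (.y (k + 2)))
      simp only [Uterm, Vterm, eval, this]

theorem eval_Uterm_eq_of_inRLAux_succ (k : ℕ) {M : Type} [i : Monoid M] [Finite M]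
    (hn : 1 ≤ n) (hid : ∀ x : M, IsIdempotentElem (x ^ n)) (hR : InRLAux (k + 1) true M i)
    (hL : InRLAux (k + 1) false M i) (g : UVLetter → M) :
    (Uterm (k + 1)).eval g n = (Vterm (k + 1)).eval g n := by
  induction k generalizing M with
  | zero =>
    have hK : IsJTrivial (KCon M).Quotient := by simpa only [InRLAux] using hR
    have hD : IsJTrivial (DCon M).Quotient := by simpa only [InRLAux] using hL
    refine eval_Uterm_one_eq (fun x y => ?_) (fun x y => ?_) g
    · have h := hK.pow_mul_eq hn (isIdempotentElem_pow_quotient hid _) ((KCon M).mk' x)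
        ((KCon M).mk' y)
      simp only [← map_mul, ← map_pow] at h
      have := (KCon_iff.1 ((Con.eq _).1 h)).symm.mul_eq_mul (s := (x * y) ^ n) (z := 1)
        (by rw [mul_one, (hid _).eq])
      rwa [← mul_assoc, (hid _).eq, eq_comm] at this
    · have h := hD.mul_pow_eq hn (isIdempotentElem_pow_quotient hid _) ((DCon M).mk' x)
        ((DCon M).mk' y)
      simp only [← map_mul, ← map_pow] at h
      have := (DCon_iff.1 ((Con.eq _).1 h)).symm.mul_eq_mul (s := (x * y) ^ n) (z := 1)
        (by rw [one_mul, (hid _).eq])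
      rwa [mul_assoc, (hid _).eq, eq_comm] at this
  | succ k ih =>
    have h := ih (isIdempotentElem_pow_quotient hid _) (hR.quotient_KDCon hL true)
      (hR.quotient_KDCon hL false) ((KDCon M).mk' ∘ g)
    rw [← map_eval, ← map_eval] at h
    simp only [Uterm, Vterm, eval, ← mul_assoc]
    exact KDCon.mul_mul_eq ((Con.eq _).1 h) (pow_mul_mul_pow_pred hn hid _ _)
      (pow_pred_mul_mul_pow hn hid _ _)

end Equations

/-- Lemma: equational characterization, necessity direction. -/
theorem trotterWeil_equations_converse (M : Type) [Monoid M] [Finite M] (m : ℕ)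
    (hm : 1 ≤ m) :
    (IsJTrivial M → EqHoldsIn (Uterm 1) (Vterm 1) M) ∧
    (InRm (m + 1) M →
      EqHoldsIn
        (PiTerm.mul (PiTerm.pi (PiTerm.mul (Uterm m) (PiTerm.letter (UVLetter.x (m + 1)))))
          (Uterm m))
        (PiTerm.mul (PiTerm.pi (PiTerm.mul (Uterm m) (PiTerm.letter (UVLetter.x (m + 1)))))
          (Vterm m)) M) ∧
    (InLm (m + 1) M →
      EqHoldsIn
        (PiTerm.mul (Uterm m)
          (PiTerm.pi (PiTerm.mul (PiTerm.letter (UVLetter.y (m + 1))) (Uterm m))))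
        (PiTerm.mul (Vterm m)
          (PiTerm.pi (PiTerm.mul (PiTerm.letter (UVLetter.y (m + 1))) (Uterm m)))) M) ∧
    (InRm (m + 1) M ∧ InLm (m + 1) M → EqHoldsIn (Uterm m) (Vterm m) M) := by
  obtain ⟨k, rfl⟩ := Nat.exists_eq_add_of_le' hm
  obtain ⟨hn, hid⟩ := monoidExp_spec M
  refine ⟨fun h => eqHoldsIn_of_eval fun g => ?_, fun h => eqHoldsIn_of_eval fun g => ?_,
    fun h => eqHoldsIn_of_eval fun g => ?_, fun h => eqHoldsIn_of_eval fun g => ?_⟩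
  · exact eval_Uterm_one_eq (h.pow_mul_eq hn hid) (h.mul_pow_eq hn hid) g
  · exact pow_mul_eval_eq hn hid (eval_Uterm_eq_of_inRLAux k false hn
      (isIdempotentElem_pow_quotient hid _) h _) _
  · exact eval_mul_pow_eq hn hid (eval_Uterm_eq_of_inRLAux k true hn
      (isIdempotentElem_pow_quotient hid _) h _) _
  · exact eval_Uterm_eq_of_inRLAux_succ k hn hid h.1 h.2 g
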